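/- arXiv:2306.06695 — 3 statements merged into one kernel-verified Lean document; each statement's English description precedes it below -/
import Mathlib

section
/- For any non-trivial bicolouring of the convex m-gon P_m (m ≥ 4), every set of pairwise non-crossing permitted diagonals is contained in a permissible triangulation, i.e., in a set of exactly m−3 pairwise non-crossing permitted diagonals. (In other words, the subcomplex of the arc complex of P_m spanned by permitted diagonals is pure of dimension m−4.) -/
/-!
Vertices of the convex `m`-gon `P_m` are identified with `ZMod m` in cyclic order.
Blue is encoded by the Boolean value `true`, red by `false`.
-/

namespace Poly

/-- A diagonal of `P_m`: an unordered pair `{i, j}` of vertices with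
`j - i ≢ 0, 1, -1 (mod m)`. -/
def IsDiag (m : ℕ) (e : Sym2 (ZMod m)) : Prop :=
  ∃ i j : ZMod m, e = s(i, j) ∧ j - i ≠ 0 ∧ j - i ≠ 1 ∧ j - i ≠ -1

/-- `x` lies in the open cyclic interval from `a` to `b` (going in the positive
cyclic direction). -/
def StrictBtw (m : ℕ) (a x b : ZMod m) : Prop :=
  0 < (x - a).val ∧ (x - a).val < (b - a).val

/-- Two diagonals `{a,b}` and `{c,d}` cross: their four endpoints are distinct and
exactly one of `c`, `d` lies in the open cyclic interval from `a` to `b`. -/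
def Cross (m : ℕ) (e f : Sym2 (ZMod m)) : Prop :=
  ∃ a b c d : ZMod m, e = s(a, b) ∧ f = s(c, d) ∧
    a ≠ b ∧ a ≠ c ∧ a ≠ d ∧ b ≠ c ∧ b ≠ d ∧ c ≠ d ∧
    Xor' (StrictBtw m a c b) (StrictBtw m a d b)

/-- A triangulation of `P_m`: a set of `m - 3` pairwise non-crossing diagonals. -/
def IsTriangulation (m : ℕ) (T : Finset (Sym2 (ZMod m))) : Prop :=
  T.card = m - 3 ∧ (∀ e ∈ T, IsDiag m e) ∧
    ∀ e ∈ T, ∀ f ∈ T, e ≠ f → ¬ Cross m e f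

/-- A bicolouring: a function from the vertices to {red, blue} attaining both values
(`true` = blue, `false` = red). -/
def IsBicolouring (m : ℕ) (c : ZMod m → Bool) : Prop :=
  (∃ v, c v = true) ∧ (∃ v, c v = false)

/-- A bicolouring is non-trivial if some diagonal has both endpoints red. -/
def IsNontrivialBicolouring (m : ℕ) (c : ZMod m → Bool) : Prop :=
  IsBicolouring m c ∧ ∃ i j : ZMod m, IsDiag m s(i, j) ∧ c i = false ∧ c j = false

/-- A diagonal is permitted if at least one of its endpoints is blue. -/
def Permitted (m : ℕ) (c : ZMod m → Bool) (e : Sym2 (ZMod m)) : Prop :=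
  ∃ v ∈ e, c v = true

/-- A permissible triangulation: a triangulation all of whose diagonals are permitted. -/
def IsPermissible (m : ℕ) (c : ZMod m → Bool) (T : Finset (Sym2 (ZMod m))) : Prop :=
  IsTriangulation m T ∧ ∀ e ∈ T, Permitted m c e

/-- Two permissible triangulations are joined in the flip graph of permissible
triangulations: there is a finite sequence of permissible triangulations from one to the
other in which consecutive triangulations share exactly `m - 4` diagonals. -/
def PermFlipJoined (m : ℕ) (c : ZMod m → Bool) (T₁ T₂ : Finset (Sym2 (ZMod m))) : Prop :=
  ∃ n : ℕ, ∃ f : Fin (n + 1) → Finset (Sym2 (ZMod m)),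
    f 0 = T₁ ∧ f (Fin.last n) = T₂ ∧ (∀ i, IsPermissible m c (f i)) ∧
    ∀ i : Fin n, (f i.castSucc ∩ f i.succ).card = m - 4

/-- `p` is a diagonal, with increasing endpoints, of the convex polygon whose vertices are the
elements of `V` in their natural order. -/
def IsChord (V : Finset ℕ) (p : ℕ × ℕ) : Prop :=
  p.1 ∈ V ∧ p.2 ∈ V ∧ (∃ k ∈ V, p.1 < k ∧ k < p.2) ∧ ∃ l ∈ V, l < p.1 ∨ p.2 < l

/-- `S` is a set of pairwise non-crossing diagonals of the polygon on `V`, each having an endpoint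
satisfying `β`. -/
def IsChordSystem (V : Finset ℕ) (β : ℕ → Prop) (S : Finset (ℕ × ℕ)) : Prop :=
  (∀ p ∈ S, IsChord V p ∧ (β p.1 ∨ β p.2)) ∧
    ∀ p ∈ S, ∀ q ∈ S, ¬ (p.1 < q.1 ∧ q.1 < p.2 ∧ p.2 < q.2)

theorem exists_isChord_of_mem {V : Finset ℕ} (hV : 4 ≤ V.card) {b : ℕ} (hb : b ∈ V) :
    ∃ p, IsChord V p ∧ (p.1 = b ∨ p.2 = b) := by
  have hcard : (V.erase b).card = V.card - 1 := Finset.card_erase_of_mem hb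
  obtain ⟨x, y, z, hx, hy, hz, hxy, hyz⟩ :
      ∃ x y z, x ∈ V.erase b ∧ y ∈ V.erase b ∧ z ∈ V.erase b ∧ x < y ∧ y < z := by
    let f := (V.erase b).orderEmbOfFin rfl
    refine ⟨f ⟨0, by omega⟩, f ⟨1, by omega⟩, f ⟨2, by omega⟩,
      Finset.orderEmbOfFin_mem _ _ _, Finset.orderEmbOfFin_mem _ _ _,
      Finset.orderEmbOfFin_mem _ _ _, ?_, ?_⟩ <;> simp
  rw [Finset.mem_erase] at hx hy hz
  rcases lt_or_gt_of_ne hx.1 with h1 | h1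
  · rcases lt_or_gt_of_ne hy.1 with h2 | h2
    · rcases lt_or_gt_of_ne hz.1 with h3 | h3
      · exact ⟨(y, b), ⟨hy.2, hb, ⟨z, hz.2, hyz, h3⟩, x, hx.2, .inl hxy⟩, .inr rfl⟩
      · exact ⟨(x, b), ⟨hx.2, hb, ⟨y, hy.2, hxy, h2⟩, z, hz.2, .inr h3⟩, .inr rfl⟩
    · exact ⟨(b, z), ⟨hb, hz.2, ⟨y, hy.2, h2, hyz⟩, x, hx.2, .inl h1⟩, .inl rfl⟩
  · exact ⟨(b, y), ⟨hb, hy.2, ⟨x, hx.2, h1, hxy⟩, z, hz.2, .inr hyz⟩, .inl rfl⟩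

theorem IsChordSystem.exists_superset_card_eq {β : ℕ → Prop} {V : Finset ℕ} {S : Finset (ℕ × ℕ)}
    (hV : 3 ≤ V.card) (hβ : ∃ b ∈ V, β b) (hS : IsChordSystem V β S) :
    ∃ T, IsChordSystem V β T ∧ S ⊆ T ∧ T.card = V.card - 3 := by
  classical
  induction h : V.card using Nat.strong_induction_on generalizing V S with
  | _ n ih =>
  subst h
  wlog hne : S.Nonempty generalizing S
  · rw [Finset.not_nonempty_iff_eq_empty] at hne
    subst hne
    rcases hV.eq_or_lt with h3 | h4
    · exact ⟨∅, hS, subset_rfl, by simp [← h3]⟩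
    obtain ⟨b, hb, hbβ⟩ := hβ
    obtain ⟨p, hp, hpb⟩ := exists_isChord_of_mem h4 hb
    obtain ⟨T, hT, -, hTc⟩ := this (S := {p}) (by
      refine ⟨fun q hq => ?_, fun q hq r hr => ?_⟩
      · rw [Finset.mem_singleton] at hq
        subst hq
        refine ⟨hp, ?_⟩
        rcases hpb with h | h <;> rw [h]
        · exact .inl hbβ
        · exact .inr hbβ
      · rw [Finset.mem_singleton] at hq hr
        subst hq hr
        omega) (Finset.singleton_nonempty p)
    exact ⟨T, hT, Finset.empty_subset _, hTc⟩
  obtain ⟨⟨i, j⟩, hij⟩ := hne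
  obtain ⟨⟨hi, hj, ⟨k, hk, hik, hkj⟩, l, hl, hlij⟩, hijβ⟩ := hS.1 _ hij
  dsimp only at hi hj hik hkj hlij hijβ
  let V₁ := V.filter (fun x => i ≤ x ∧ x ≤ j)
  let V₂ := V.filter (fun x => x ≤ i ∨ j ≤ x)
  have mem₁ : ∀ x, x ∈ V₁ ↔ x ∈ V ∧ i ≤ x ∧ x ≤ j := fun x => Finset.mem_filter
  have mem₂ : ∀ x, x ∈ V₂ ↔ x ∈ V ∧ (x ≤ i ∨ j ≤ x) := fun x => Finset.mem_filter
  have hunion : V₁ ∪ V₂ = V := by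
    ext x
    rw [Finset.mem_union, mem₁, mem₂]
    constructor
    · rintro (h | h) <;> exact h.1
    · intro h
      by_cases h1 : i ≤ x ∧ x ≤ j
      · exact .inl ⟨h, h1⟩
      · exact .inr ⟨h, by omega⟩
  have hinter : V₁ ∩ V₂ = {i, j} := by
    ext x
    rw [Finset.mem_inter, mem₁, mem₂, Finset.mem_insert, Finset.mem_singleton]
    constructor
    · rintro ⟨⟨-, h⟩, -, h'⟩
      omega
    · rintro (rfl | rfl)
      · exact ⟨⟨hi, by omega⟩, hi, by omega⟩
      · exact ⟨⟨hj, by omega⟩, hj, by omega⟩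
  have hcard : V₁.card + V₂.card = V.card + 2 := by
    rw [← Finset.card_union_add_card_inter, hunion, hinter, Finset.card_pair (by omega)]
  have hi₁ : i ∈ V₁ := (mem₁ i).2 ⟨hi, by omega⟩
  have hj₁ : j ∈ V₁ := (mem₁ j).2 ⟨hj, by omega⟩
  have hi₂ : i ∈ V₂ := (mem₂ i).2 ⟨hi, by omega⟩
  have hj₂ : j ∈ V₂ := (mem₂ j).2 ⟨hj, by omega⟩
  have hc₁ : 3 ≤ V₁.card := Finset.two_lt_card.2
    ⟨i, hi₁, j, hj₁, k, (mem₁ k).2 ⟨hk, by omega⟩, by omega, by omega, by omega⟩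
  have hc₂ : 3 ≤ V₂.card := Finset.two_lt_card.2
    ⟨i, hi₂, j, hj₂, l, (mem₂ l).2 ⟨hl, by omega⟩, by omega, by omega, by omega⟩
  have hβ₁ : ∃ b ∈ V₁, β b := hijβ.elim (fun h => ⟨i, hi₁, h⟩) (fun h => ⟨j, hj₁, h⟩)
  have hβ₂ : ∃ b ∈ V₂, β b := hijβ.elim (fun h => ⟨i, hi₂, h⟩) (fun h => ⟨j, hj₂, h⟩)
  have hS₁ : IsChordSystem V₁ β (S.filter (IsChord V₁)) := by
    refine ⟨fun p hp => ?_, fun p hp q hq => ?_⟩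
    · rw [Finset.mem_filter] at hp
      exact ⟨hp.2, (hS.1 p hp.1).2⟩
    · exact hS.2 p (Finset.mem_filter.1 hp).1 q (Finset.mem_filter.1 hq).1
  have hS₂ : IsChordSystem V₂ β (S.filter (IsChord V₂)) := by
    refine ⟨fun p hp => ?_, fun p hp q hq => ?_⟩
    · rw [Finset.mem_filter] at hp
      exact ⟨hp.2, (hS.1 p hp.1).2⟩
    · exact hS.2 p (Finset.mem_filter.1 hp).1 q (Finset.mem_filter.1 hq).1
  obtain ⟨T₁, hT₁, hST₁, hTc₁⟩ := ih V₁.card (by omega) hc₁ hβ₁ hS₁ rfl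
  obtain ⟨T₂, hT₂, hST₂, hTc₂⟩ := ih V₂.card (by omega) hc₂ hβ₂ hS₂ rfl
  have bound₁ : ∀ p ∈ T₁, i ≤ p.1 ∧ p.1 < p.2 ∧ p.2 ≤ j ∧ (i < p.1 ∨ p.2 < j) := by
    intro p hp
    obtain ⟨h1, h2, ⟨k', hk', hk''⟩, l', hl', hl''⟩ := (hT₁.1 p hp).1
    rw [mem₁] at h1 h2 hl'
    omega
  have bound₂ : ∀ p ∈ T₂, (p.1 ≤ i ∨ j ≤ p.1) ∧ (p.2 ≤ i ∨ j ≤ p.2) ∧ p.1 < p.2 ∧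
      (p.1 ≠ i ∨ p.2 ≠ j) := by
    intro p hp
    obtain ⟨h1, h2, ⟨k', hk', hk''⟩, l', hl', hl''⟩ := (hT₂.1 p hp).1
    rw [mem₂] at h1 h2 hk'
    omega
  have chord₁ : ∀ p, IsChord V₁ p → IsChord V p := by
    rintro p ⟨h1, h2, ⟨k', hk', hk''⟩, l', hl', hl''⟩
    exact ⟨((mem₁ _).1 h1).1, ((mem₁ _).1 h2).1, ⟨k', ((mem₁ _).1 hk').1, hk''⟩,
      l', ((mem₁ _).1 hl').1, hl''⟩
  have chord₂ : ∀ p, IsChord V₂ p → IsChord V p := by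
    rintro p ⟨h1, h2, ⟨k', hk', hk''⟩, l', hl', hl''⟩
    exact ⟨((mem₂ _).1 h1).1, ((mem₂ _).1 h2).1, ⟨k', ((mem₂ _).1 hk').1, hk''⟩,
      l', ((mem₂ _).1 hl').1, hl''⟩
  refine ⟨insert (i, j) (T₁ ∪ T₂), ⟨fun p hp => ?_, fun p hp q hq => ?_⟩, fun p hp => ?_, ?_⟩
  · rw [Finset.mem_insert, Finset.mem_union] at hp
    rcases hp with rfl | hp | hp
    · exact hS.1 _ hij
    · exact ⟨chord₁ p (hT₁.1 p hp).1, (hT₁.1 p hp).2⟩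
    · exact ⟨chord₂ p (hT₂.1 p hp).1, (hT₂.1 p hp).2⟩
  · rw [Finset.mem_insert, Finset.mem_union] at hp hq
    rcases hp with rfl | hp | hp <;> rcases hq with rfl | hq | hq
    · dsimp only
      omega
    · have := bound₁ q hq
      dsimp only
      omega
    · have := bound₂ q hq
      dsimp only
      omega
    · have := bound₁ p hp
      dsimp only
      omega
    · exact hT₁.2 p hp q hq
    · have := bound₁ p hp
      have := bound₂ q hq
      omega
    · have := bound₂ p hp
      dsimp only
      omega
    · have := bound₂ p hp
      have := bound₁ q hq
      omega
    · exact hT₂.2 p hp q hq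
  · rw [Finset.mem_insert, Finset.mem_union]
    by_cases hpij : p = (i, j)
    · exact .inl hpij
    right
    have hne : p.1 ≠ i ∨ p.2 ≠ j := by
      by_contra! hcon
      exact hpij (Prod.ext hcon.1 hcon.2)
    have h1 := hS.2 p hp _ hij
    have h2 := hS.2 _ hij p hp
    dsimp only at h1 h2
    obtain ⟨hp1, hp2, ⟨k', hk', hk''⟩, l', hl', hl''⟩ := (hS.1 p hp).1
    by_cases hin : i ≤ p.1 ∧ p.2 ≤ j
    · left
      refine hST₁ (Finset.mem_filter.2 ⟨hp, (mem₁ _).2 ⟨hp1, by omega⟩, (mem₁ _).2 ⟨hp2, by omega⟩,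
        ⟨k', (mem₁ _).2 ⟨hk', by omega⟩, hk''⟩, ?_⟩)
      rcases hne with hne | hne
      · exact ⟨i, hi₁, by omega⟩
      · exact ⟨j, hj₁, by omega⟩
    · right
      refine hST₂ (Finset.mem_filter.2 ⟨hp, (mem₂ _).2 ⟨hp1, by omega⟩, (mem₂ _).2 ⟨hp2, by omega⟩,
        ?_, ?_⟩)
      · by_cases hk2 : k' ≤ i ∨ j ≤ k'
        · exact ⟨k', (mem₂ _).2 ⟨hk', hk2⟩, hk''⟩
        · by_cases hpi : p.1 < i
          · exact ⟨i, hi₂, by omega⟩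
          · exact ⟨j, hj₂, by omega⟩
      · by_cases hl2 : l' ≤ i ∨ j ≤ l'
        · exact ⟨l', (mem₂ _).2 ⟨hl', hl2⟩, hl''⟩
        · by_cases hpi : i < p.1
          · exact ⟨i, hi₂, by omega⟩
          · exact ⟨j, hj₂, by omega⟩
  · have hdisj : Disjoint T₁ T₂ := by
      rw [Finset.disjoint_left]
      intro p hp hp'
      have := bound₁ p hp
      have := bound₂ p hp'
      omega
    have hnot : (i, j) ∉ T₁ ∪ T₂ := by
      rw [Finset.mem_union]
      rintro (h | h)
      · have := bound₁ _ h
        dsimp only at this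
        omega
      · have := bound₂ _ h
        dsimp only at this
        omega
    rw [Finset.card_insert_of_notMem hnot, Finset.card_union_of_disjoint hdisj]
    omega

theorem val_sub_eq_ite {m : ℕ} [NeZero m] (x a : ZMod m) :
    (x - a).val = if a.val ≤ x.val then x.val - a.val else x.val + m - a.val := by
  split_ifs with h
  · exact ZMod.val_sub h
  · have hsum := ZMod.val_add (x - a) a
    have h1 := ZMod.val_lt (x - a)
    have h2 := ZMod.val_lt a
    rw [sub_add_cancel] at hsum
    by_cases h3 : (x - a).val + a.val < m
    · rw [Nat.mod_eq_of_lt h3] at hsum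
      omega
    · rw [Nat.mod_eq_sub_mod (by omega), Nat.mod_eq_of_lt (by omega)] at hsum
      omega

theorem cross_of_val_lt {m : ℕ} [NeZero m] {a b c d : ZMod m} (h₁ : a.val < c.val)
    (h₂ : c.val < b.val) (h₃ : b.val < d.val) : Cross m s(a, b) s(c, d) := by
  refine ⟨a, b, c, d, rfl, rfl, ?_, ?_, ?_, ?_, ?_, ?_, .inl ⟨?_, ?_⟩⟩
  any_goals
    rintro rfl
    omega
  · unfold StrictBtw
    rw [val_sub_eq_ite, val_sub_eq_ite, if_pos (by omega), if_pos (by omega)]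
    omega
  · unfold StrictBtw
    rw [val_sub_eq_ite, val_sub_eq_ite, if_pos (by omega), if_pos (by omega)]
    omega

theorem Cross.val_lt {m : ℕ} [NeZero m] {a b c d : ZMod m} (hab : a.val < b.val)
    (hcd : c.val < d.val) (h : Cross m s(a, b) s(c, d)) :
    (a.val < c.val ∧ c.val < b.val ∧ b.val < d.val) ∨
      (c.val < a.val ∧ a.val < d.val ∧ d.val < b.val) := by
  obtain ⟨a', b', c', d', h₁, h₂, -, hac, had, hbc, hbd, -, hx⟩ := h
  have inj : ∀ {x y : ZMod m}, x ≠ y → x.val ≠ y.val := fun hxy h => hxy (ZMod.val_injective m h)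
  have hac := inj hac
  have had := inj had
  have hbc := inj hbc
  have hbd := inj hbd
  have hav := ZMod.val_lt a
  have hbv := ZMod.val_lt b
  have hcv := ZMod.val_lt c
  have hdv := ZMod.val_lt d
  unfold StrictBtw at hx
  simp only [val_sub_eq_ite] at hx
  rw [Sym2.eq_iff] at h₁ h₂
  rcases h₁ with ⟨rfl, rfl⟩ | ⟨rfl, rfl⟩ <;> rcases h₂ with ⟨rfl, rfl⟩ | ⟨rfl, rfl⟩ <;>
    rcases hx with hx | hx <;> split_ifs at hx <;> omega

theorem isDiag_mk_iff {m : ℕ} (hm : 4 ≤ m) {a b : ZMod m} (hab : a.val < b.val) :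
    IsDiag m s(a, b) ↔ IsChord (Finset.range m) (a.val, b.val) := by
  have : NeZero m := ⟨by omega⟩
  have : Fact (1 < m) := ⟨by omega⟩
  have hav := ZMod.val_lt a
  have hbv := ZMod.val_lt b
  have hchord : IsChord (Finset.range m) (a.val, b.val) ↔
      b.val - a.val ≠ 1 ∧ b.val - a.val ≠ m - 1 := by
    simp only [IsChord, Finset.mem_range]
    constructor
    · rintro ⟨-, -, ⟨k, hk⟩, l, hl⟩
      omega
    · intro h
      refine ⟨hav, hbv, ⟨a.val + 1, by omega⟩, ?_⟩
      by_cases h0 : a.val = 0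
      · exact ⟨m - 1, by omega⟩
      · exact ⟨0, by omega⟩
  have hneg : (-1 : ZMod m).val = m - 1 := by
    rw [ZMod.neg_val, if_neg one_ne_zero, ZMod.val_one]
  have key : ∀ x y : ZMod m, (y - x ≠ 0 ∧ y - x ≠ 1 ∧ y - x ≠ -1) ↔
      (y - x).val ≠ 0 ∧ (y - x).val ≠ 1 ∧ (y - x).val ≠ m - 1 := by
    intro x y
    rw [← hneg, ← ZMod.val_one m, ← ZMod.val_zero (n := m)]
    simp only [ne_eq, (ZMod.val_injective m).eq_iff]
  rw [hchord]
  constructor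
  · rintro ⟨x, y, h, hxy⟩
    rw [key, val_sub_eq_ite] at hxy
    rw [Sym2.eq_iff] at h
    rcases h with ⟨rfl, rfl⟩ | ⟨rfl, rfl⟩ <;> split_ifs at hxy <;> omega
  · intro h
    refine ⟨a, b, rfl, ?_⟩
    rw [key, val_sub_eq_ite, if_pos hab.le]
    omega

theorem exists_eq_mk_val_lt {m : ℕ} {e : Sym2 (ZMod m)} [NeZero m] (he : IsDiag m e) :
    ∃ a b : ZMod m, e = s(a, b) ∧ a.val < b.val := by
  obtain ⟨a, b, rfl, h, -⟩ := he
  have hne : a.val ≠ b.val := fun h' => h (sub_eq_zero.2 (ZMod.val_injective m h').symm)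
  rcases lt_or_gt_of_ne hne with h | h
  · exact ⟨a, b, rfl, h⟩
  · exact ⟨b, a, Sym2.eq_swap, h⟩

/-- For any non-trivial bicolouring of `P_m` (`m ≥ 4`), every set of
pairwise non-crossing permitted diagonals is contained in a permissible triangulation. -/
theorem permitted_subcomplex_pure (m : ℕ) (hm : 4 ≤ m) (c : ZMod m → Bool)
    (hc : IsNontrivialBicolouring m c)
    (S : Finset (Sym2 (ZMod m)))
    (hSdiag : ∀ e ∈ S, IsDiag m e ∧ Permitted m c e)
    (hScross : ∀ e ∈ S, ∀ f ∈ S, e ≠ f → ¬ Cross m e f) :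
    ∃ T : Finset (Sym2 (ZMod m)), IsPermissible m c T ∧ S ⊆ T := by
  classical
  have : NeZero m := ⟨by omega⟩
  let β : ℕ → Prop := fun i => c (i : ZMod m) = true
  have hβ : ∀ x : ZMod m, β x.val ↔ c x = true := fun x => by
    simp only [β, ZMod.natCast_zmod_val]
  let V := Finset.range m
  let S' : Finset (ℕ × ℕ) :=
    (V ×ˢ V).filter fun p => p.1 < p.2 ∧ s((p.1 : ZMod m), (p.2 : ZMod m)) ∈ S
  have lift : ∀ p : ℕ × ℕ, p.1 < m → p.2 < m → ∃ a b : ZMod m, p = (a.val, b.val) := fun p h₁ h₂ =>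
    ⟨p.1, p.2, by rw [ZMod.val_cast_of_lt h₁, ZMod.val_cast_of_lt h₂]⟩
  have memS' : ∀ a b : ZMod m, (a.val, b.val) ∈ S' ↔ a.val < b.val ∧ s(a, b) ∈ S := by
    intro a b
    simp [S', V, ZMod.val_lt]
  have repS' : ∀ p ∈ S', ∃ a b : ZMod m, p = (a.val, b.val) ∧ a.val < b.val ∧ s(a, b) ∈ S := by
    intro p hp
    have hp' := Finset.mem_product.1 (Finset.mem_filter.1 hp).1
    obtain ⟨a, b, rfl⟩ := lift p (Finset.mem_range.1 hp'.1) (Finset.mem_range.1 hp'.2)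
    exact ⟨a, b, rfl, (memS' a b).1 hp⟩
  have permitted_iff : ∀ a b : ZMod m, Permitted m c s(a, b) ↔ β a.val ∨ β b.val := by
    intro a b
    simp [Permitted, hβ]
  have hS' : IsChordSystem V β S' := by
    refine ⟨fun p hp => ?_, fun p hp q hq hpq => ?_⟩
    · obtain ⟨a, b, rfl, hab, hmem⟩ := repS' p hp
      exact ⟨(isDiag_mk_iff hm hab).1 (hSdiag _ hmem).1, (permitted_iff a b).1 (hSdiag _ hmem).2⟩
    · obtain ⟨a, b, rfl, hab, hmem⟩ := repS' p hp
      obtain ⟨a', b', rfl, hab', hmem'⟩ := repS' q hq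
      dsimp only at hpq
      refine hScross _ hmem _ hmem' (fun h => ?_) (cross_of_val_lt hpq.1 hpq.2.1 hpq.2.2)
      rw [Sym2.eq_iff] at h
      rcases h with ⟨rfl, rfl⟩ | ⟨rfl, rfl⟩ <;> omega
  obtain ⟨v, hv⟩ := hc.1.1
  obtain ⟨T, hT, hST, hTc⟩ := hS'.exists_superset_card_eq (by rw [Finset.card_range]; omega)
    ⟨v.val, Finset.mem_range.2 (ZMod.val_lt v), (hβ v).2 hv⟩
  have repT : ∀ p ∈ T, ∃ a b : ZMod m, p = (a.val, b.val) ∧ a.val < b.val := by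
    intro p hp
    obtain ⟨h₁, h₂, ⟨k, -, hk⟩, -⟩ := (hT.1 p hp).1
    obtain ⟨a, b, rfl⟩ := lift p (Finset.mem_range.1 h₁) (Finset.mem_range.1 h₂)
    exact ⟨a, b, rfl, hk.1.trans hk.2⟩
  let g : ℕ × ℕ → Sym2 (ZMod m) := fun p => s((p.1 : ZMod m), (p.2 : ZMod m))
  have hg : ∀ a b : ZMod m, g (a.val, b.val) = s(a, b) := fun a b => by simp [g]
  have repImage : ∀ e ∈ T.image g,
      ∃ a b : ZMod m, e = s(a, b) ∧ a.val < b.val ∧ (a.val, b.val) ∈ T := by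
    intro e he
    obtain ⟨p, hp, rfl⟩ := Finset.mem_image.1 he
    obtain ⟨a, b, rfl, hab⟩ := repT p hp
    exact ⟨a, b, hg a b, hab, hp⟩
  refine ⟨T.image g, ⟨⟨?_, fun e he => ?_, fun e he f hf _ hef => ?_⟩, fun e he => ?_⟩,
    fun e he => ?_⟩
  · rw [Finset.card_image_of_injOn, hTc, Finset.card_range]
    intro p hp q hq hpq
    obtain ⟨a, b, rfl, hab⟩ := repT p hp
    obtain ⟨a', b', rfl, hab'⟩ := repT q hq
    rw [hg, hg, Sym2.eq_iff] at hpq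
    rcases hpq with ⟨rfl, rfl⟩ | ⟨rfl, rfl⟩
    · rfl
    · omega
  · obtain ⟨a, b, rfl, hab, hmem⟩ := repImage e he
    exact (isDiag_mk_iff hm hab).2 (hT.1 _ hmem).1
  · obtain ⟨a, b, rfl, hab, hmem⟩ := repImage e he
    obtain ⟨a', b', rfl, hab', hmem'⟩ := repImage f hf
    rcases hef.val_lt hab hab' with h | h
    · exact hT.2 _ hmem _ hmem' h
    · exact hT.2 _ hmem' _ hmem h
  · obtain ⟨a, b, rfl, -, hmem⟩ := repImage e he
    exact (permitted_iff a b).2 (hT.1 _ hmem).2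
  · obtain ⟨a, b, rfl, hab⟩ := exists_eq_mk_val_lt (hSdiag e he).1
    exact Finset.mem_image.2 ⟨(a.val, b.val), hST ((memS' a b).2 ⟨hab, he⟩), hg a b⟩

end Poly
end

section
/- For any non-trivial bicolouring of the convex m-gon P_m (m ≥ 4), the flip graph of permissible triangulations is connected: any two permissible triangulations are joined by a finite sequence of permissible triangulations in which consecutive triangulations share exactly m−4 diagonals. -/
/-!
Vertices of the convex `m`-gon `P_m` are identified with `ZMod m` in cyclic order.
Blue is encoded by the Boolean value `true`, red by `false`.
-/

namespace Poly

section Position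

variable {m : ℕ}

/-- The position of `x` when the vertices are numbered cyclically starting from `v`. -/
def pos (v x : ZMod m) : ℕ := (x - v).val

lemma pos_self (v : ZMod m) : pos v v = 0 := by simp [pos]

lemma exists_pos_eq (v : ZMod m) {k : ℕ} (hk : k < m) : ∃ x, pos v x = k :=
  ⟨v + k, by simp [pos, ZMod.val_natCast, Nat.mod_eq_of_lt hk]⟩

lemma cross_iff {e f : Sym2 (ZMod m)} : Cross m e f ↔
    ∃ a b c d : ZMod m, e = s(a, b) ∧ f = s(c, d) ∧
      a ≠ b ∧ a ≠ c ∧ a ≠ d ∧ b ≠ c ∧ b ≠ d ∧ c ≠ d ∧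
      (StrictBtw m a c b ∧ ¬ StrictBtw m a d b ∨ StrictBtw m a d b ∧ ¬ StrictBtw m a c b) :=
  Iff.rfl

variable [NeZero m]

lemma pos_lt (v x : ZMod m) : pos v x < m := ZMod.val_lt _

lemma pos_injective (v : ZMod m) : Function.Injective (pos v) := fun x y h => by
  simpa using ZMod.val_injective m h

lemma pos_eq_zero {v x : ZMod m} : pos v x = 0 ↔ x = v := by
  rw [← pos_self v, (pos_injective v).eq_iff]

lemma val_sub_of_pos_le {v x y : ZMod m} (h : pos v x ≤ pos v y) :
    (y - x).val = pos v y - pos v x := by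
  rw [← sub_sub_sub_cancel_right y x v, ZMod.val_sub h, pos, pos]

lemma val_sub_of_pos_lt {v x y : ZMod m} (h : pos v y < pos v x) :
    (y - x).val = m + pos v y - pos v x := by
  have hne : x - y ≠ 0 := sub_ne_zero.2 fun hxy => by simp [hxy] at h
  have : NeZero (x - y) := ⟨hne⟩
  have hlt := pos_lt v x
  rw [← neg_sub x y, ZMod.val_neg_of_ne_zero, val_sub_of_pos_le h.le]
  omega

lemma strictBtw_iff (v a x b : ZMod m) : StrictBtw m a x b ↔
    pos v a < pos v x ∧ pos v x < pos v b ∨ pos v b < pos v a ∧ pos v a < pos v x ∨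
      pos v x < pos v b ∧ pos v b < pos v a := by
  have ha := pos_lt v a
  have hb := pos_lt v b
  have hx := pos_lt v x
  unfold StrictBtw
  rcases le_or_gt (pos v a) (pos v x) with h₁ | h₁ <;>
    rcases le_or_gt (pos v a) (pos v b) with h₂ | h₂ <;>
    first
      | rw [val_sub_of_pos_le h₁, val_sub_of_pos_le h₂]
      | rw [val_sub_of_pos_le h₁, val_sub_of_pos_lt h₂]
      | rw [val_sub_of_pos_lt h₁, val_sub_of_pos_le h₂]
      | rw [val_sub_of_pos_lt h₁, val_sub_of_pos_lt h₂]
  all_goals omega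

lemma cross_of_pos_lt {v a b c d : ZMod m} (hac : pos v a < pos v c)
    (hcb : pos v c < pos v b) (hbd : pos v b < pos v d) : Cross m s(a, b) s(c, d) := by
  refine cross_iff.2 ⟨a, b, c, d, rfl, rfl, ?_⟩
  simp only [strictBtw_iff v, ne_eq, ← (pos_injective v).eq_iff]
  omega

lemma pos_lt_of_cross {v a b c d : ZMod m} (hab : pos v a < pos v b) (hcd : pos v c < pos v d)
    (h : Cross m s(a, b) s(c, d)) :
    pos v a < pos v c ∧ pos v c < pos v b ∧ pos v b < pos v d ∨
      pos v c < pos v a ∧ pos v a < pos v d ∧ pos v d < pos v b := by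
  obtain ⟨a', b', c', d', he, hf, h⟩ := cross_iff.1 h
  simp only [strictBtw_iff v, ne_eq, ← (pos_injective v).eq_iff] at h
  rcases Sym2.eq_iff.1 he with ⟨rfl, rfl⟩ | ⟨rfl, rfl⟩ <;>
    rcases Sym2.eq_iff.1 hf with ⟨rfl, rfl⟩ | ⟨rfl, rfl⟩ <;> omega

lemma Cross.symm {e f : Sym2 (ZMod m)} (h : Cross m e f) : Cross m f e := by
  obtain ⟨a, b, c, d, rfl, rfl, hcr⟩ := cross_iff.1 h
  refine cross_iff.2 ⟨c, d, a, b, rfl, rfl, ?_⟩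
  simp only [strictBtw_iff 0, ne_eq, ← (pos_injective (0 : ZMod m)).eq_iff] at hcr ⊢
  omega

lemma IsDiag.exists_pos_lt (v : ZMod m) {e : Sym2 (ZMod m)} (he : IsDiag m e) :
    ∃ a b, e = s(a, b) ∧ pos v a + 1 < pos v b := by
  have key : ∀ i j : ZMod m, j - i ≠ 1 → pos v i < pos v j → pos v i + 1 < pos v j := by
    intro i j hij hlt
    by_contra hcon
    refine hij ?_
    have h1 : (j - i).val = 1 := by rw [val_sub_of_pos_le hlt.le]; omega
    rw [← ZMod.natCast_zmod_val (j - i), h1, Nat.cast_one]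
  obtain ⟨i, j, rfl, h0, h1, hneg⟩ := he
  have hne : pos v i ≠ pos v j := fun h => h0 (by rw [pos_injective v h, sub_self])
  rcases hne.lt_or_gt with h | h
  · exact ⟨i, j, rfl, key i j h1 h⟩
  · exact ⟨j, i, Sym2.eq_swap, key j i (fun h' => hneg (by rw [← neg_sub, h'])) h⟩

lemma isDiag_of_pos {v x : ZMod m} (h1 : 1 < pos v x) (h2 : pos v x + 1 < m) :
    IsDiag m s(v, x) := by
  have : Fact (1 < m) := ⟨by omega⟩
  refine ⟨v, x, rfl, fun h => ?_, fun h => ?_, fun h => ?_⟩ <;> simp only [pos, h] at h1 h2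
  · simp at h1
  · simp [ZMod.val_one] at h1
  · rw [ZMod.val_neg_of_ne_zero, ZMod.val_one] at h2
    omega

end Position

/-- If some diagonal of a triangulation avoids `v`, then some diagonal avoiding `v` can be
flipped to a diagonal through `v`. -/
lemma exists_flip {m : ℕ} [NeZero m] {T : Finset (Sym2 (ZMod m))} (hT : IsTriangulation m T)
    {v : ZMod m} (hv : ∃ e ∈ T, v ∉ e) :
    ∃ e ∈ T, v ∉ e ∧ ∃ x, s(v, x) ∉ T ∧ IsTriangulation m (insert s(v, x) (T.erase e)) := by
  obtain ⟨hcard, hdiag, hcross⟩ := hT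
  have noncross : ∀ a b c d, s(a, b) ∈ T → s(c, d) ∈ T →
      ¬ (pos v a < pos v c ∧ pos v c < pos v b ∧ pos v b < pos v d) := by
    rintro a b c d he hf ⟨h1, h2, h3⟩
    refine hcross _ he _ hf (fun h => ?_) (cross_of_pos_lt h1 h2 h3)
    rcases Sym2.eq_iff.1 h with ⟨rfl, rfl⟩ | ⟨rfl, rfl⟩ <;> omega
  obtain ⟨⟨a, b⟩, hab, hmax⟩ := Finset.exists_max_image
    {q : ZMod m × ZMod m | s(q.1, q.2) ∈ T ∧ 0 < pos v q.1 ∧ pos v q.1 < pos v q.2}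
    (fun q => pos v q.2 - pos v q.1) (by
      obtain ⟨e, he, hve⟩ := hv
      obtain ⟨a, b, rfl, hlt⟩ := (hdiag e he).exists_pos_lt v
      refine ⟨(a, b), (Finset.mem_filter_univ _).2 ⟨he, ?_, Nat.lt_of_succ_lt hlt⟩⟩
      refine Nat.pos_of_ne_zero fun h => hve ?_
      exact Sym2.mem_iff.2 (.inl (pos_eq_zero.1 h).symm))
  simp only [Finset.mem_filter_univ, Prod.forall] at hab hmax
  obtain ⟨habT, ha0, hablt⟩ := hab
  have hab2 : pos v a + 1 < pos v b := by
    obtain ⟨a', b', h, hlt⟩ := (hdiag _ habT).exists_pos_lt v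
    rcases Sym2.eq_iff.1 h with ⟨rfl, rfl⟩ | ⟨rfl, rfl⟩ <;> omega
  have hbm := pos_lt v b
  obtain ⟨x, hx, hxmax⟩ := Finset.exists_max_image
    {y : ZMod m | pos v a < pos v y ∧ pos v y < pos v b ∧
      (s(a, y) ∈ T ∨ pos v y = pos v a + 1)} (pos v) (by
      obtain ⟨y, hy⟩ := exists_pos_eq v (k := pos v a + 1) (by omega)
      exact ⟨y, by simp [hy, hab2]⟩)
  simp only [Finset.mem_filter_univ] at hx hxmax
  obtain ⟨hax, hxb, hx⟩ := hx
  have hv0 := pos_self v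
  have hva : v ∉ s(a, b) := by
    simp only [Sym2.mem_iff, ← (pos_injective v).eq_iff]
    omega
  have hxT : s(v, x) ∉ T := fun h => noncross v x a b h habT ⟨by omega, hax, hxb⟩
  have hnew : ∀ f ∈ T, f ≠ s(a, b) → ¬ Cross m s(v, x) f := by
    intro f hf hne hcr
    obtain ⟨c, d, rfl, hcd⟩ := (hdiag f hf).exists_pos_lt v
    have hpos := pos_lt_of_cross (v := v) (by omega) (by omega) hcr
    have hne' : ¬ (pos v c = pos v a ∧ pos v d = pos v b) := fun h =>
      hne (by rw [pos_injective v h.1, pos_injective v h.2])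
    have hgap := hmax c d ⟨hf, by omega, by omega⟩
    have h1 := noncross a b c d habT hf
    have h2 := noncross c d a b hf habT
    have hac : pos v a ≤ pos v c ∧ pos v d ≤ pos v b := by omega
    rcases hac.1.eq_or_lt with h | h
    · obtain rfl := pos_injective v h
      have := hxmax d ⟨by omega, by omega, Or.inl hf⟩
      omega
    · rcases hx with hx | hx
      · exact noncross a x c d hx hf ⟨h, by omega, by omega⟩
      · omega
  refine ⟨s(a, b), habT, hva, x, hxT, ?_, ?_, ?_⟩
  · rw [Finset.card_insert_of_notMem (fun h => hxT (Finset.mem_of_mem_erase h)),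
      Finset.card_erase_add_one habT, hcard]
  · intro f hf
    rcases Finset.mem_insert.1 hf with rfl | hf
    · exact isDiag_of_pos (by omega) (by omega)
    · exact hdiag f (Finset.mem_of_mem_erase hf)
  · intro f hf g hg hfg
    rcases Finset.mem_insert.1 hf with rfl | hf <;> rcases Finset.mem_insert.1 hg with rfl | hg
    · exact absurd rfl hfg
    · exact hnew g (Finset.mem_of_mem_erase hg) (Finset.ne_of_mem_erase hg)
    · exact fun h => hnew f (Finset.mem_of_mem_erase hf) (Finset.ne_of_mem_erase hf) h.symm
    · exact hcross f (Finset.mem_of_mem_erase hf) g (Finset.mem_of_mem_erase hg) hfg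

/-- All diagonals through the vertex `v`. -/
def fan {m : ℕ} [NeZero m] (v : ZMod m) : Finset (Sym2 (ZMod m)) :=
  (Finset.univ \ {v, v + 1, v - 1}).image fun x => s(v, x)

lemma card_fan_le {m : ℕ} [NeZero m] (hm : 4 ≤ m) (v : ZMod m) : (fan v).card ≤ m - 3 := by
  refine Finset.card_image_le.trans ?_
  have : Fact (1 < m) := ⟨by omega⟩
  have h2 : (1 : ZMod m) ≠ -1 := fun h => by
    have h := congrArg ZMod.val h
    rw [ZMod.val_neg_of_ne_zero, ZMod.val_one] at h
    omega
  have hcard : ({v, v + 1, v - 1} : Finset (ZMod m)).card = 3 := by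
    refine Finset.card_eq_three.2 ⟨v, v + 1, v - 1, ?_, ?_, ?_, rfl⟩
    · simp
    · simp [eq_comm (a := v), sub_eq_self]
    · rwa [sub_eq_add_neg, Ne, add_right_inj]
  rw [Finset.card_sdiff_of_subset (Finset.subset_univ _), hcard, Finset.card_univ, ZMod.card]

lemma IsTriangulation.eq_fan {m : ℕ} [NeZero m] (hm : 4 ≤ m) {T : Finset (Sym2 (ZMod m))}
    (hT : IsTriangulation m T) {v : ZMod m} (hv : ∀ e ∈ T, v ∈ e) : T = fan v := by
  refine Finset.eq_of_subset_of_card_le (fun e he => ?_) ((card_fan_le hm v).trans hT.1.ge)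
  obtain ⟨i, j, rfl, h0, h1, hneg⟩ := hT.2.1 e he
  simp only [fan, Finset.mem_image, Finset.mem_sdiff, Finset.mem_univ, true_and,
    Finset.mem_insert, Finset.mem_singleton, not_or]
  rcases Sym2.mem_iff.1 (hv _ he) with rfl | rfl
  · refine ⟨j, ⟨?_, ?_, ?_⟩, rfl⟩ <;> rintro rfl <;> simp at h0 h1 hneg
  · refine ⟨i, ⟨?_, ?_, ?_⟩, Sym2.eq_swap⟩ <;> rintro rfl <;> simp at h0 h1 hneg

/-- Adjacency in the flip graph of permissible triangulations. -/
def FlipAdj (m : ℕ) (c : ZMod m → Bool) (T T' : Finset (Sym2 (ZMod m))) : Prop :=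
  IsPermissible m c T ∧ IsPermissible m c T' ∧ (T ∩ T').card = m - 4

lemma FlipAdj.symm {m : ℕ} {c : ZMod m → Bool} {T T' : Finset (Sym2 (ZMod m))}
    (h : FlipAdj m c T T') : FlipAdj m c T' T :=
  ⟨h.2.1, h.1, Finset.inter_comm T T' ▸ h.2.2⟩

lemma reflTransGen_fan {m : ℕ} [NeZero m] (hm : 4 ≤ m) {c : ZMod m → Bool} {v : ZMod m}
    (hcv : c v = true) (T : Finset (Sym2 (ZMod m))) (hT : IsPermissible m c T) :
    Relation.ReflTransGen (FlipAdj m c) T (fan v) := by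
  induction hn : (T.filter (v ∉ ·)).card using Nat.strong_induction_on generalizing T with
  | _ n ih =>
  by_cases hv : ∃ e ∈ T, v ∉ e
  · obtain ⟨e, he, hve, x, hx, hT'⟩ := exists_flip hT.1 hv
    have hperm : IsPermissible m c (insert s(v, x) (T.erase e)) := by
      refine ⟨hT', fun f hf => ?_⟩
      rcases Finset.mem_insert.1 hf with rfl | hf
      · exact ⟨v, Sym2.mem_mk_left v x, hcv⟩
      · exact hT.2 f (Finset.mem_of_mem_erase hf)
    refine .head (b := insert s(v, x) (T.erase e)) ⟨hT, hperm, ?_⟩ (ih _ ?_ _ hperm rfl)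
    · rw [Finset.inter_insert_of_notMem hx,
        Finset.inter_eq_right.2 (Finset.erase_subset e T), Finset.card_erase_of_mem he, hT.1.1]
      omega
    · rw [← hn, Finset.filter_insert, if_neg (by simp), Finset.filter_erase]
      exact Finset.card_erase_lt_of_mem (Finset.mem_filter.2 ⟨he, hve⟩)
  · push Not at hv
    rw [hT.1.eq_fan hm hv]

lemma permFlipJoined_of_reflTransGen {m : ℕ} {c : ZMod m → Bool}
    {T₁ T₂ : Finset (Sym2 (ZMod m))} (hT₂ : IsPermissible m c T₂)
    (h : Relation.ReflTransGen (FlipAdj m c) T₁ T₂) : PermFlipJoined m c T₁ T₂ := by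
  induction h using Relation.ReflTransGen.head_induction_on with
  | refl => exact ⟨0, fun _ => T₂, rfl, rfl, fun _ => hT₂, fun i => i.elim0⟩
  | @head T T' hadj _ ih =>
    obtain ⟨n, f, h0, hlast, hperm, hcard⟩ := ih
    refine ⟨n + 1, Fin.cons T f, rfl, ?_, ?_, ?_⟩
    · rw [← Fin.succ_last, Fin.cons_succ, hlast]
    · exact Fin.cases hadj.1 hperm
    · refine Fin.cases ?_ fun i => ?_
      · simpa [h0] using hadj.2.2
      · simpa [← Fin.succ_castSucc] using hcard i

/-- For any non-trivial bicolouring of `P_m` (`m ≥ 4`), the flip graph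
of permissible triangulations is connected: any two permissible triangulations are joined
by a finite sequence of permissible triangulations in which consecutive triangulations
share exactly `m - 4` diagonals. -/
theorem perm_flip_graph_connected (m : ℕ) (hm : 4 ≤ m) (c : ZMod m → Bool)
    (hc : IsNontrivialBicolouring m c)
    (T₁ T₂ : Finset (Sym2 (ZMod m)))
    (hT₁ : IsPermissible m c T₁) (hT₂ : IsPermissible m c T₂) :
    PermFlipJoined m c T₁ T₂ := by
  have : NeZero m := ⟨by omega⟩
  obtain ⟨v, hcv⟩ := hc.1.1
  have : Std.Symm (FlipAdj m c) := ⟨fun _ _ h => h.symm⟩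
  exact permFlipJoined_of_reflTransGen hT₂ ((reflTransGen_fan hm hcv T₁ hT₁).trans
    (symm_of _ (reflTransGen_fan hm hcv T₂ hT₂)))

end Poly
end

section
/- For any bicolouring of the convex m-gon P_m (m ≥ 4), there is an enumeration T_1, …, T_N of all permissible triangulations of P_m such that for all indices 1 ≤ j < k ≤ N there exists i < k with |T_i ∩ T_k| = m−4 and T_j ∩ T_k ⊆ T_i ∩ T_k. (That is, the complex of permitted diagonals satisfies Wilson's shelling property.) -/
/-!
Vertices of the convex `m`-gon `P_m` are identified with `ZMod m` in cyclic order.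
Blue is encoded by the Boolean value `true`, red by `false`.
-/

namespace Poly

/-- `IsTree c a b U`: the set `U` of arcs `(i, j)`, `i + 2 ≤ j`, is the arc set (root arc `(a, b)`
included) of a triangulation of the polygon with vertices `a, a + 1, …, b`, every arc of which
has an endpoint coloured `true`. -/
inductive IsTree (c : ℕ → Bool) : ℕ → ℕ → Finset (ℕ × ℕ) → Prop
  | edge (a : ℕ) : IsTree c a (a + 1) ∅
  | node {a x b : ℕ} {L R : Finset (ℕ × ℕ)} (hL : IsTree c a x L) (hR : IsTree c x b R)
      (h : c a = true ∨ c b = true) : IsTree c a b (insert (a, b) (L ∪ R))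

namespace IsTree

variable {c : ℕ → Bool} {a b x y : ℕ} {L R U L' R' : Finset (ℕ × ℕ)}

theorem lt (h : IsTree c a b U) : a < b := by
  induction h with
  | edge a => omega
  | node _ _ _ h₁ h₂ => omega

theorem bounds (h : IsTree c a b U) : ∀ e ∈ U, a ≤ e.1 ∧ e.1 + 2 ≤ e.2 ∧ e.2 ≤ b := by
  induction h with
  | edge a => simp
  | node hL hR _ h₁ h₂ =>
    have := hL.lt
    have := hR.lt
    intro e he
    simp only [Finset.mem_insert, Finset.mem_union] at he
    rcases he with rfl | he | he
    · simp only; omega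
    · have := h₁ e he; omega
    · have := h₂ e he; omega

theorem coloured (h : IsTree c a b U) : ∀ e ∈ U, c e.1 = true ∨ c e.2 = true := by
  induction h with
  | edge a => simp
  | node hL hR h h₁ h₂ =>
    intro e he
    simp only [Finset.mem_insert, Finset.mem_union] at he
    rcases he with rfl | he | he
    · exact h
    · exact h₁ e he
    · exact h₂ e he

theorem root_mem (h : IsTree c a b U) (hab : a + 2 ≤ b) : (a, b) ∈ U := by
  cases h with
  | edge a => omega
  | node => simp

theorem not_cross (h : IsTree c a b U) :
    ∀ e ∈ U, ∀ f ∈ U, ¬ (e.1 < f.1 ∧ f.1 < e.2 ∧ e.2 < f.2) := by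
  induction h with
  | edge a => simp
  | node hL hR _ h₁ h₂ =>
    have := hL.lt
    have := hR.lt
    intro e he f hf
    simp only [Finset.mem_insert, Finset.mem_union] at he hf
    have b₁ := hL.bounds
    have b₂ := hR.bounds
    rcases he with rfl | he | he <;> rcases hf with rfl | hf | hf
    · omega
    · have := b₁ f hf; omega
    · have := b₂ f hf; omega
    · have := b₁ e he; omega
    · exact h₁ e he f hf
    · have := b₁ e he; have := b₂ f hf; omega
    · have := b₂ e he; omega
    · have := b₂ e he; have := b₁ f hf; omega
    · exact h₂ e he f hf

theorem left_eq (hL : IsTree c a x L) (hR : IsTree c x b R) :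
    (insert (a, b) (L ∪ R)).filter (fun e => e.2 ≤ x) = L := by
  ext e
  have := hR.lt
  have b₁ := hL.bounds e
  have b₂ := hR.bounds e
  simp only [Finset.mem_filter, Finset.mem_insert, Finset.mem_union]
  constructor
  · rintro ⟨rfl | h | h, h'⟩
    · simp only at h'; omega
    · exact h
    · have := b₂ h; omega
  · intro h
    exact ⟨Or.inr (Or.inl h), (b₁ h).2.2⟩

theorem right_eq (hL : IsTree c a x L) (hR : IsTree c x b R) :
    (insert (a, b) (L ∪ R)).filter (fun e => x ≤ e.1) = R := by
  ext e
  have := hL.lt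
  have b₁ := hL.bounds e
  have b₂ := hR.bounds e
  simp only [Finset.mem_filter, Finset.mem_insert, Finset.mem_union]
  constructor
  · rintro ⟨rfl | h | h, h'⟩
    · simp only at h'; omega
    · have := b₁ h; omega
    · exact h
  · intro h
    exact ⟨Or.inr (Or.inr h), (b₂ h).1⟩

theorem card_eq (h : IsTree c a b U) : U.card = b - a - 1 := by
  induction h with
  | edge a => simp
  | @node a x b L R hL hR _ h₁ h₂ =>
    have := hL.lt
    have := hR.lt
    have b₁ := hL.bounds
    have b₂ := hR.bounds
    rw [Finset.card_insert_of_notMem, Finset.card_union_of_disjoint, h₁, h₂]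
    · omega
    · rw [Finset.disjoint_left]
      intro e he he'
      have := b₁ e he
      have := b₂ e he'
      omega
    · intro he
      rcases Finset.mem_union.1 he with he | he
      · have := (b₁ _ he).2.2; simp only at this; omega
      · have := (b₂ _ he).1; simp only at this; omega

theorem exists_node (h : IsTree c a b U) (hab : a + 2 ≤ b) :
    ∃ x L R, IsTree c a x L ∧ IsTree c x b R ∧ (c a = true ∨ c b = true) ∧
      U = insert (a, b) (L ∪ R) := by
  cases h with
  | edge a => omega
  | node hL hR h => exact ⟨_, _, _, hL, hR, h, rfl⟩

theorem not_apex_lt (hU : IsTree c a b U) (hx : IsTree c x b R) (hy : IsTree c a y L)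
    (hRU : R ⊆ U) (hLU : L ⊆ U) (hax : a < x) (hyb : y < b) : y ≤ x := by
  by_contra! hxy
  exact hU.not_cross _ (hLU (hy.root_mem (by omega))) _ (hRU (hx.root_mem (by omega)))
    ⟨hax, hxy, hyb⟩

theorem apex_unique (hL : IsTree c a x L) (hR : IsTree c x b R) (hL' : IsTree c a y L')
    (hR' : IsTree c y b R') (h : c a = true ∨ c b = true)
    (he : insert (a, b) (L ∪ R) = insert (a, b) (L' ∪ R')) : x = y ∧ L = L' ∧ R = R' := by
  have hU := IsTree.node hL hR h
  have sL : L ⊆ insert (a, b) (L ∪ R) := by grind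
  have sR : R ⊆ insert (a, b) (L ∪ R) := by grind
  have sL' : L' ⊆ insert (a, b) (L ∪ R) := by grind
  have sR' : R' ⊆ insert (a, b) (L ∪ R) := by grind
  have h₁ := hU.not_apex_lt hR hL' sR sL' hL.lt hR'.lt
  have h₂ := hU.not_apex_lt hR' hL sR' sL hL'.lt hR.lt
  obtain rfl : x = y := le_antisymm h₂ h₁
  refine ⟨rfl, ?_, ?_⟩
  · rw [← left_eq hL hR, he, left_eq hL' hR']
  · rw [← right_eq hL hR, he, right_eq hL' hR']

theorem finite (c : ℕ → Bool) (a b : ℕ) : {U | IsTree c a b U}.Finite := by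
  refine (Finset.finite_toSet (Finset.Icc a b ×ˢ Finset.Icc a b).powerset).subset ?_
  intro U hU
  simp only [Finset.coe_powerset, Set.mem_preimage, Set.mem_powerset_iff, Finset.coe_subset]
  intro e he
  have := IsTree.bounds hU e he
  simp only [Finset.mem_product, Finset.mem_Icc]
  omega

end IsTree

/-- A noncrossing set of arcs on `a, …, b` has at most `b - a - 1` elements, and those of
maximal size come from trees. -/
theorem card_le_and_isTree (c : ℕ → Bool) (n : ℕ) : ∀ (a b : ℕ) (U : Finset (ℕ × ℕ)),
    b - a = n → a < b → (∀ e ∈ U, a ≤ e.1 ∧ e.1 + 2 ≤ e.2 ∧ e.2 ≤ b) →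
    (∀ e ∈ U, ∀ f ∈ U, ¬ (e.1 < f.1 ∧ f.1 < e.2 ∧ e.2 < f.2)) →
    U.card ≤ b - a - 1 ∧
      (U.card = b - a - 1 → (∀ e ∈ U, c e.1 = true ∨ c e.2 = true) → IsTree c a b U) := by
  induction n using Nat.strong_induction_on with
  | _ n ih =>
  intro a b U hn hab hU hcross
  rcases Nat.lt_or_ge b (a + 2) with hb | hb
  · obtain rfl : b = a + 1 := by omega
    obtain rfl : U = ∅ := by
      refine Finset.eq_empty_of_forall_notMem fun e he => ?_
      have := hU e he
      omega
    exact ⟨by simp, fun _ _ => .edge a⟩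
  obtain ⟨x, hx, hmax⟩ := Finset.exists_max_image
    ((Finset.Ioo a b).filter (fun x => x = a + 1 ∨ (a, x) ∈ U)) id
    ⟨a + 1, by simp only [Finset.mem_filter, Finset.mem_Ioo, true_or, and_true]; omega⟩
  simp only [Finset.mem_filter, Finset.mem_Ioo, id] at hx hmax
  obtain ⟨⟨hax, hxb⟩, hx⟩ := hx
  obtain ⟨cL, tL⟩ := ih (x - a) (by omega) a x (U.filter (fun e => e.2 ≤ x)) rfl hax
    (fun e he => by
      have := hU e (Finset.mem_filter.1 he).1
      have := (Finset.mem_filter.1 he).2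
      omega)
    (fun e he f hf => hcross e (Finset.mem_filter.1 he).1 f (Finset.mem_filter.1 hf).1)
  obtain ⟨cR, tR⟩ := ih (b - x) (by omega) x b (U.filter (fun e => x ≤ e.1)) rfl hxb
    (fun e he => by
      have := hU e (Finset.mem_filter.1 he).1
      have := (Finset.mem_filter.1 he).2
      omega)
    (fun e he f hf => hcross e (Finset.mem_filter.1 he).1 f (Finset.mem_filter.1 hf).1)
  set L := U.filter (fun e => e.2 ≤ x) with hL
  set R := U.filter (fun e => x ≤ e.1) with hR
  have hsub : U ⊆ insert (a, b) (L ∪ R) := by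
    rintro ⟨i, j⟩ he
    have h₀ := hU _ he
    simp only at h₀
    simp only [hL, hR, Finset.mem_insert, Finset.mem_union, Finset.mem_filter, he, true_and,
      Prod.mk.injEq]
    by_contra! hcon
    obtain ⟨h₁, h₂, h₃⟩ := hcon
    have hi : i = a := by
      by_contra hne
      rcases hx with hx | hx
      · omega
      · exact hcross _ hx _ he ⟨by simp only; omega, h₃, h₂⟩
    subst hi
    have := hmax j ⟨⟨by omega, by have := h₁ rfl; omega⟩, Or.inr he⟩
    omega
  have h₁ := Finset.card_le_card hsub
  have h₂ := Finset.card_insert_le (a, b) (L ∪ R)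
  have h₃ := Finset.card_union_le L R
  refine ⟨by omega, fun hcard hc => ?_⟩
  have heq : U = insert (a, b) (L ∪ R) := Finset.eq_of_subset_of_card_le hsub (by omega)
  have hroot : c a = true ∨ c b = true := hc (a, b) (by rw [heq]; simp)
  rw [heq]
  exact .node (tL (by omega) fun e he => hc e (Finset.mem_filter.1 he).1)
    (tR (by omega) fun e he => hc e (Finset.mem_filter.1 he).1) hroot

/-- An injective key on a finite set may be replaced by a natural-number-valued one inducing
the same order. -/
theorem exists_nat_key {α β : Type*} [LinearOrder β] {S : Set α} (hS : S.Finite) (key : α → β) :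
    ∃ k : α → ℕ, ∀ s ∈ S, ∀ t ∈ S, k s < k t ↔ key s < key t := by
  classical
  refine ⟨fun t => (hS.toFinset.filter (fun s => key s < key t)).card, fun s hs t ht => ?_⟩
  constructor
  · intro h
    by_contra! hle
    refine absurd h (not_lt.2 (Finset.card_le_card fun u hu => ?_))
    simp only [Finset.mem_filter] at hu ⊢
    exact ⟨hu.1, hu.2.trans_le hle⟩
  · intro h
    refine Finset.card_lt_card ⟨fun u hu => ?_, fun hsub => ?_⟩
    · simp only [Finset.mem_filter] at hu ⊢
      exact ⟨hu.1, hu.2.trans h⟩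
    · have := hsub (Finset.mem_filter.2 ⟨hS.mem_toFinset.2 hs, h⟩)
      exact lt_irrefl _ (Finset.mem_filter.1 this).2

/-- The key orders the family `S` as a shelling. -/
def IsShellingKey {α β : Type*} [DecidableEq α] [LT β] (S : Set (Finset α)) (key : Finset α → β) :
    Prop :=
  Set.InjOn key S ∧ ∀ T ∈ S, ∀ T' ∈ S, key T' < key T →
    ∃ T'' ∈ S, key T'' < key T ∧ ∃ e ∈ T, e ∉ T' ∧ T.erase e ⊆ T''

theorem IsShellingKey.exists_nat {α β : Type*} [DecidableEq α] [LinearOrder β]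
    {S : Set (Finset α)} {key : Finset α → β} (h : IsShellingKey S key) (hS : S.Finite) :
    ∃ k : Finset α → ℕ, IsShellingKey S k := by
  obtain ⟨k, hk⟩ := exists_nat_key hS key
  refine ⟨k, fun s hs t ht hst => h.1 hs ht ?_, fun T hT T' hT' hlt => ?_⟩
  · have h₁ := (hk s hs t ht).not.1 (by omega)
    have h₂ := (hk t ht s hs).not.1 (by omega)
    exact le_antisymm (not_lt.1 h₂) (not_lt.1 h₁)
  · obtain ⟨T'', hT'', hlt', he⟩ := h.2 T hT T' hT' ((hk _ hT' _ hT).1 hlt)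
    exact ⟨T'', hT'', (hk _ hT'' _ hT).2 hlt', he⟩

theorem exists_flip_left {c : ℕ → Bool} {a b x x' : ℕ} {L R L' R' : Finset (ℕ × ℕ)}
    (hL : IsTree c a x L) (hR : IsTree c x b R) (hL' : IsTree c a x' L') (hR' : IsTree c x' b R')
    (hb : c b = true) (hlt : x' < x) :
    ∃ z L'' R'', z < x ∧ IsTree c a z L'' ∧ IsTree c z b R'' ∧
      ∃ e ∈ insert (a, b) (L ∪ R), e ∉ insert (a, b) (L' ∪ R') ∧
        (insert (a, b) (L ∪ R)).erase e ⊆ insert (a, b) (L'' ∪ R'') := by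
  have h₁ := hL'.lt
  have h₂ := hR.lt
  obtain ⟨z, L₁, L₂, hL₁, hL₂, -, rfl⟩ := hL.exists_node (by omega)
  refine ⟨z, L₁, _, hL₂.lt, hL₁, .node hL₂ hR (Or.inr hb), (a, x), by simp, fun hmem => ?_, ?_⟩
  · refine (IsTree.node hL' hR' (Or.inr hb)).not_cross _ hmem (x', b) ?_ ⟨h₁, hlt, h₂⟩
    simp [hR'.root_mem (by omega)]
  · intro e
    simp only [Finset.mem_erase, Finset.mem_insert, Finset.mem_union]
    tauto

theorem exists_flip_right {c : ℕ → Bool} {a b x x' : ℕ} {L R L' R' : Finset (ℕ × ℕ)}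
    (hL : IsTree c a x L) (hR : IsTree c x b R) (hL' : IsTree c a x' L') (hR' : IsTree c x' b R')
    (ha : c a = true) (hlt : x < x') :
    ∃ z L'' R'', x < z ∧ IsTree c a z L'' ∧ IsTree c z b R'' ∧
      ∃ e ∈ insert (a, b) (L ∪ R), e ∉ insert (a, b) (L' ∪ R') ∧
        (insert (a, b) (L ∪ R)).erase e ⊆ insert (a, b) (L'' ∪ R'') := by
  have h₁ := hR'.lt
  have h₂ := hL.lt
  obtain ⟨z, R₁, R₂, hR₁, hR₂, -, rfl⟩ := hR.exists_node (by omega)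
  refine ⟨z, _, R₂, hR₁.lt, .node hL hR₁ (Or.inl ha), hR₂, (x, b), by simp, fun hmem => ?_, ?_⟩
  · refine (IsTree.node hL' hR' (Or.inl ha)).not_cross (a, x') ?_ _ hmem ⟨h₂, hlt, h₁⟩
    simp [hL'.root_mem (by omega)]
  · intro e
    simp only [Finset.mem_erase, Finset.mem_insert, Finset.mem_union]
    tauto

theorem exists_shellingKey_isTree (c : ℕ → Bool) (n : ℕ) : ∀ a b : ℕ, b - a = n →
    ∃ key : Finset (ℕ × ℕ) → ℕ, IsShellingKey {U | IsTree c a b U} key := by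
  induction n using Nat.strong_induction_on with
  | _ n ih =>
  intro a b hn
  rcases Nat.lt_or_ge b (a + 2) with hb | hb
  · have hempty : ∀ U, IsTree c a b U → U = ∅ := by
      intro U hU
      have := hU.card_eq
      exact Finset.card_eq_zero.1 (by omega)
    refine ⟨fun _ => 0, fun s hs t ht _ => ?_, fun _ _ _ _ h => absurd h (lt_irrefl _)⟩
    rw [hempty s hs, hempty t ht]
  have hk₁ : ∀ x, ∃ k : Finset (ℕ × ℕ) → ℕ, x < b → IsShellingKey {U | IsTree c a x U} k := by
    intro x
    by_cases hx : x < b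
    · obtain ⟨k, hk⟩ := ih (x - a) (by omega) a x rfl
      exact ⟨k, fun _ => hk⟩
    · exact ⟨fun _ => 0, fun h => absurd h hx⟩
  have hk₂ : ∀ x, ∃ k : Finset (ℕ × ℕ) → ℕ, a < x → IsShellingKey {U | IsTree c x b U} k := by
    intro x
    by_cases hx : a < x
    · obtain ⟨k, hk⟩ := ih (b - x) (by omega) x b rfl
      exact ⟨k, fun _ => hk⟩
    · exact ⟨fun _ => 0, fun h => absurd h hx⟩
  choose kL hkL using hk₁
  choose kR hkR using hk₂
  have hdec : ∀ U : Finset (ℕ × ℕ), ∃ p : ℕ × Finset (ℕ × ℕ) × Finset (ℕ × ℕ), IsTree c a b U →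
      IsTree c a p.1 p.2.1 ∧ IsTree c p.1 b p.2.2 ∧ (c a = true ∨ c b = true) ∧
        U = insert (a, b) (p.2.1 ∪ p.2.2) := by
    intro U
    by_cases hU : IsTree c a b U
    · obtain ⟨x, L, R, h⟩ := hU.exists_node hb
      exact ⟨(x, L, R), fun _ => h⟩
    · exact ⟨(0, ∅, ∅), fun h => absurd h hU⟩
  choose p hp using hdec
  have p_node : ∀ {x L R}, IsTree c a x L → IsTree c x b R → (c a = true ∨ c b = true) →
      p (insert (a, b) (L ∪ R)) = (x, L, R) := by
    intro x L R hL hR h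
    obtain ⟨h₁, h₂, -, h₄⟩ := hp _ (.node hL hR h)
    obtain ⟨e₁, e₂, e₃⟩ := IsTree.apex_unique hL hR h₁ h₂ h h₄
    exact Prod.ext e₁.symm (Prod.ext e₂.symm e₃.symm)
  let ρ : ℕ → ℕ := fun x => if c b = true then x else b - x
  let key : Finset (ℕ × ℕ) → ℕ ×ₗ ℕ ×ₗ ℕ := fun U =>
    toLex (ρ (p U).1, toLex (kL (p U).1 (p U).2.1, kR (p U).1 (p U).2.2))
  have key_node : ∀ {x L R}, IsTree c a x L → IsTree c x b R → (c a = true ∨ c b = true) →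
      key (insert (a, b) (L ∪ R)) = toLex (ρ x, toLex (kL x L, kR x R)) := by
    intro x L R hL hR h
    simp only [key, p_node hL hR h]
  have ρ_inj : ∀ {x y}, x < b → y < b → ρ x = ρ y → x = y := by
    intro x y hx hy h
    simp only [ρ] at h
    split_ifs at h <;> omega
  refine IsShellingKey.exists_nat (key := key) ⟨?_, ?_⟩ (IsTree.finite c a b)
  · intro U hU V hV huv
    obtain ⟨x, L, R, hL, hR, h, rfl⟩ := IsTree.exists_node hU hb
    obtain ⟨y, L', R', hL', hR', -, rfl⟩ := IsTree.exists_node hV hb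
    rw [key_node hL hR h, key_node hL' hR' h] at huv
    simp only [EmbeddingLike.apply_eq_iff_eq, Prod.mk.injEq] at huv
    obtain ⟨h₁, h₂, h₃⟩ := huv
    obtain rfl := ρ_inj hR.lt hR'.lt h₁
    rw [(hkL x hR.lt).1 hL hL' h₂, (hkR x hL.lt).1 hR hR' h₃]
  · intro U hU V hV hlt
    obtain ⟨x, L, R, hL, hR, h, rfl⟩ := IsTree.exists_node hU hb
    obtain ⟨y, L', R', hL', hR', -, rfl⟩ := IsTree.exists_node hV hb
    rw [key_node hL hR h, key_node hL' hR' h] at hlt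
    rw [Prod.Lex.toLex_lt_toLex, Prod.Lex.toLex_lt_toLex] at hlt
    simp only at hlt
    have hxb := hR.lt
    have hyb := hR'.lt
    rcases hlt with hlt | ⟨hxy, hlt⟩
    · have hflip : ∃ z L'' R'', ρ z < ρ x ∧ IsTree c a z L'' ∧ IsTree c z b R'' ∧
          ∃ e ∈ insert (a, b) (L ∪ R), e ∉ insert (a, b) (L' ∪ R') ∧
            (insert (a, b) (L ∪ R)).erase e ⊆ insert (a, b) (L'' ∪ R'') := by
        by_cases hcb : c b = true
        · simp only [ρ, hcb, if_true] at hlt ⊢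
          exact exists_flip_left hL hR hL' hR' hcb hlt
        · simp only [ρ, hcb, Bool.false_eq_true, if_false] at hlt ⊢
          obtain ⟨z, L'', R'', hz, hrest⟩ :=
            exists_flip_right hL hR hL' hR' (h.resolve_right hcb) (by omega : x < y)
          exact ⟨z, L'', R'', by omega, hrest⟩
      obtain ⟨z, L'', R'', hz, hL'', hR'', he⟩ := hflip
      refine ⟨_, .node hL'' hR'' h, ?_, he⟩
      rw [key_node hL hR h, key_node hL'' hR'' h, Prod.Lex.toLex_lt_toLex]
      exact Or.inl hz
    obtain rfl := ρ_inj hyb hxb hxy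
    rcases hlt with hlt | ⟨hk, hlt⟩
    · obtain ⟨L'', hL'', hlt', e, he, he', hsub⟩ := (hkL y hxb).2 L hL L' hL' hlt
      refine ⟨_, .node hL'' hR h, ?_, e, by simp [he], ?_, ?_⟩
      · rw [key_node hL hR h, key_node hL'' hR h, Prod.Lex.toLex_lt_toLex,
          Prod.Lex.toLex_lt_toLex]
        exact Or.inr ⟨rfl, Or.inl hlt'⟩
      · intro hmem
        refine he' ?_
        rw [← IsTree.left_eq hL' hR']
        exact Finset.mem_filter.2 ⟨hmem, (hL.bounds e he).2.2⟩
      · intro f hf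
        have := @hsub f
        simp only [Finset.mem_erase, Finset.mem_insert, Finset.mem_union] at hf this ⊢
        tauto
    · obtain rfl := (hkL y hxb).1 hL' hL hk
      obtain ⟨R'', hR'', hlt', e, he, he', hsub⟩ := (hkR y hL.lt).2 R hR R' hR' hlt
      refine ⟨_, .node hL hR'' h, ?_, e, by simp [he], ?_, ?_⟩
      · rw [key_node hL hR h, key_node hL hR'' h, Prod.Lex.toLex_lt_toLex,
          Prod.Lex.toLex_lt_toLex]
        exact Or.inr ⟨rfl, Or.inr ⟨rfl, hlt'⟩⟩
      · intro hmem
        refine he' ?_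
        rw [← IsTree.right_eq hL' hR']
        exact Finset.mem_filter.2 ⟨hmem, (hR.bounds e he).1⟩
      · intro f hf
        have := @hsub f
        simp only [Finset.mem_erase, Finset.mem_insert, Finset.mem_union] at hf this ⊢
        tauto

/-- The pair of vertices of `P_m` obtained from an arc `(i, j)` by counting from `w`. -/
def arcPair (m : ℕ) (w : ZMod m) (e : ℕ × ℕ) : Sym2 (ZMod m) :=
  s(w + (e.1 : ZMod m), w + (e.2 : ZMod m))

theorem val_add_sub_add {m i k : ℕ} [NeZero m] (w : ZMod m) (hi : i < m) (hk : k < m) :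
    ((w + (k : ZMod m)) - (w + (i : ZMod m))).val = if i ≤ k then k - i else m + k - i := by
  have h : ∀ n < m, (n : ZMod m) = (w + (k : ZMod m)) - (w + (i : ZMod m)) →
      ((w + (k : ZMod m)) - (w + (i : ZMod m))).val = n := by
    intro n hn he
    rw [← he, ZMod.val_cast_of_lt hn]
  split_ifs with hik
  · refine h _ (by omega) ?_
    rw [Nat.cast_sub hik]; ring
  · refine h _ (by omega) ?_
    rw [Nat.cast_sub (by omega)]
    push_cast
    rw [ZMod.natCast_self]; ring

theorem exists_eq_add {m : ℕ} [NeZero m] (w v : ZMod m) : ∃ i < m, v = w + (i : ZMod m) :=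
  ⟨(v - w).val, ZMod.val_lt _, by rw [ZMod.natCast_val, ZMod.cast_id]; ring⟩

theorem add_natCast_inj {m i j : ℕ} [NeZero m] {w : ZMod m} (hi : i < m) (hj : j < m) :
    w + (i : ZMod m) = w + (j : ZMod m) ↔ i = j := by
  rw [add_right_inj, ZMod.natCast_eq_natCast_iff', Nat.mod_eq_of_lt hi, Nat.mod_eq_of_lt hj]

theorem arcPair_eq_iff {m i j p q : ℕ} [NeZero m] {w : ZMod m} (hi : i < m) (hj : j < m)
    (hp : p < m) (hq : q < m) :
    arcPair m w (i, j) = arcPair m w (p, q) ↔ (i = p ∧ j = q) ∨ (i = q ∧ j = p) := by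
  simp only [arcPair, Sym2.eq_iff, add_natCast_inj hi hp, add_natCast_inj hj hq,
    add_natCast_inj hi hq, add_natCast_inj hj hp]

theorem strictBtw_iff_s6 {m i k j : ℕ} [NeZero m] {w : ZMod m} (hi : i < m) (hk : k < m)
    (hj : j < m) (hij : i < j) :
    StrictBtw m (w + (i : ZMod m)) (w + (k : ZMod m)) (w + (j : ZMod m)) ↔ i < k ∧ k < j := by
  rw [StrictBtw, val_add_sub_add w hi hk, val_add_sub_add w hi hj]
  split_ifs <;> omega

theorem strictBtw_iff_of_gt {m i k j : ℕ} [NeZero m] {w : ZMod m} (hi : i < m) (hk : k < m)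
    (hj : j < m) (hij : j < i) :
    StrictBtw m (w + (i : ZMod m)) (w + (k : ZMod m)) (w + (j : ZMod m)) ↔ i < k ∨ k < j := by
  rw [StrictBtw, val_add_sub_add w hi hk, val_add_sub_add w hi hj]
  split_ifs <;> omega

theorem cross_arcPair_iff {m : ℕ} [NeZero m] {w : ZMod m} {e f : ℕ × ℕ} (he : e.1 < e.2)
    (he' : e.2 < m) (hf : f.1 < f.2) (hf' : f.2 < m) :
    Cross m (arcPair m w e) (arcPair m w f) ↔
      (e.1 < f.1 ∧ f.1 < e.2 ∧ e.2 < f.2) ∨ (f.1 < e.1 ∧ e.1 < f.2 ∧ f.2 < e.2) := by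
  obtain ⟨i, j⟩ := e
  obtain ⟨k, l⟩ := f
  simp only at he he' hf hf' ⊢
  have hi : i < m := by omega
  have hk : k < m := by omega
  constructor
  · rintro ⟨a, b, c, d, h₁, h₂, -, hac, had, hbc, hbd, -, hx⟩
    obtain ⟨p, hp, rfl⟩ := exists_eq_add w a
    obtain ⟨q, hq, rfl⟩ := exists_eq_add w b
    obtain ⟨r, hr, rfl⟩ := exists_eq_add w c
    obtain ⟨s, hs, rfl⟩ := exists_eq_add w d
    replace h₁ := (arcPair_eq_iff hi he' hp hq).1 h₁
    replace h₂ := (arcPair_eq_iff hk hf' hr hs).1 h₂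
    rw [Ne, add_natCast_inj (by assumption) (by assumption)] at hac had hbc hbd
    change Xor _ _ at hx
    rcases h₁ with ⟨rfl, rfl⟩ | ⟨rfl, rfl⟩
    · rw [strictBtw_iff_s6 hp hr hq he, strictBtw_iff_s6 hp hs hq he, xor_def] at hx
      omega
    · rw [strictBtw_iff_of_gt hp hr hq he, strictBtw_iff_of_gt hp hs hq he, xor_def] at hx
      omega
  · intro h
    refine ⟨_, _, _, _, rfl, rfl, ?_, ?_, ?_, ?_, ?_, ?_, (?_ : Xor _ _)⟩ <;>
    simp only [Ne, add_natCast_inj hi he', add_natCast_inj hi hk, add_natCast_inj hi hf',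
      add_natCast_inj he' hk, add_natCast_inj he' hf', add_natCast_inj hk hf',
      strictBtw_iff_s6 hi hk he' he, strictBtw_iff_s6 hi hf' he' he, xor_def] <;>
    omega

theorem isDiag_arcPair_iff {m : ℕ} (hm : 4 ≤ m) {w : ZMod m} {e : ℕ × ℕ} (he : e.1 < e.2)
    (he' : e.2 < m) :
    IsDiag m (arcPair m w e) ↔ e.1 + 2 ≤ e.2 ∧ e ≠ (0, m - 1) := by
  have : NeZero m := ⟨by omega⟩
  obtain ⟨i, j⟩ := e
  simp only at he he' ⊢
  have hi : i < m := by omega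
  have key : ∀ {p q}, p < m → q < m →
      (((w + (q : ZMod m)) - (w + (p : ZMod m)) ≠ 0 ∧ (w + (q : ZMod m)) - (w + (p : ZMod m)) ≠ 1 ∧
        (w + (q : ZMod m)) - (w + (p : ZMod m)) ≠ -1) ↔
      q ≠ p ∧ q ≠ p + 1 ∧ p ≠ q + 1 ∧ ¬ (p = 0 ∧ q = m - 1) ∧ ¬ (q = 0 ∧ p = m - 1)) := by
    intro p q hp hq
    have h₀ := val_add_sub_add w hp hq
    have h₁ : (1 : ZMod m).val = 1 := by
      rw [ZMod.val_one_eq_one_mod, Nat.mod_eq_of_lt (by omega)]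
    have h₂ : (-1 : ZMod m).val = m - 1 := by
      have : NeZero (1 : ZMod m) := ⟨fun h => by rw [h, ZMod.val_zero] at h₁; omega⟩
      rw [ZMod.val_neg_of_ne_zero, h₁]
    rw [Ne, Ne, Ne, ← (ZMod.val_injective m).eq_iff, ← (ZMod.val_injective m).eq_iff (b := 1),
      ← (ZMod.val_injective m).eq_iff (b := -1), h₀, h₁, h₂, ZMod.val_zero]
    split_ifs <;> omega
  constructor
  · rintro ⟨a, b, h, hd⟩
    obtain ⟨p, hp, rfl⟩ := exists_eq_add w a
    obtain ⟨q, hq, rfl⟩ := exists_eq_add w b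
    rw [key hp hq] at hd
    replace h := (arcPair_eq_iff hi he' hp hq).1 h
    rw [Ne, Prod.mk.injEq]
    omega
  · intro h
    rw [Ne, Prod.mk.injEq] at h
    exact ⟨_, _, rfl, (key hi he').2 (by omega)⟩

theorem IsDiag.exists_arc {m : ℕ} (hm : 4 ≤ m) (w : ZMod m) {e : Sym2 (ZMod m)}
    (he : IsDiag m e) : ∃ a : ℕ × ℕ, a.1 + 2 ≤ a.2 ∧ a.2 < m ∧ a ≠ (0, m - 1) ∧
      arcPair m w a = e := by
  have : NeZero m := ⟨by omega⟩
  have hd := he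
  obtain ⟨a, b, rfl, h₀, -, -⟩ := he
  obtain ⟨p, hp, rfl⟩ := exists_eq_add w a
  obtain ⟨q, hq, rfl⟩ := exists_eq_add w b
  rcases lt_trichotomy p q with h | rfl | h
  · have := (isDiag_arcPair_iff hm (w := w) (e := (p, q)) h hq).1 hd
    exact ⟨(p, q), this.1, hq, this.2, rfl⟩
  · exact absurd (sub_self _) h₀
  · rw [Sym2.eq_swap] at hd ⊢
    have := (isDiag_arcPair_iff hm (w := w) (e := (q, p)) h hp).1 hd
    exact ⟨(q, p), this.1, hp, this.2, rfl⟩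

theorem arcPair_injOn {m : ℕ} [NeZero m] (w : ZMod m) :
    Set.InjOn (arcPair m w) {e | e.1 < e.2 ∧ e.2 < m} := by
  rintro ⟨i, j⟩ ⟨h₁, h₂⟩ ⟨k, l⟩ ⟨h₃, h₄⟩ h
  simp only at h₁ h₂ h₃ h₄
  have := (arcPair_eq_iff (by omega) h₂ (by omega) h₄).1 h
  rw [Prod.mk.injEq]
  omega

theorem permitted_arcPair_iff {m : ℕ} {c : ZMod m → Bool} {w : ZMod m} {e : ℕ × ℕ} :
    Permitted m c (arcPair m w e) ↔
      c (w + (e.1 : ZMod m)) = true ∨ c (w + (e.2 : ZMod m)) = true := by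
  simp [Permitted, arcPair, Sym2.mem_iff]

/-- The diagonals of `P_m` given by the non-root arcs of a tree on `0, …, m - 1`. -/
def diagonals (m : ℕ) (w : ZMod m) (U : Finset (ℕ × ℕ)) : Finset (Sym2 (ZMod m)) :=
  (U.erase (0, m - 1)).image (arcPair m w)

section Transfer

variable {m : ℕ} {c : ZMod m → Bool} {w : ZMod m} {U : Finset (ℕ × ℕ)}

theorem arcPair_mem_diagonals_iff [NeZero m] (hU : ∀ e ∈ U, e.1 < e.2 ∧ e.2 < m)
    {e : ℕ × ℕ} (he : e.1 < e.2 ∧ e.2 < m) :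
    arcPair m w e ∈ diagonals m w U ↔ e ≠ (0, m - 1) ∧ e ∈ U := by
  rw [diagonals, Finset.mem_image]
  constructor
  · rintro ⟨f, hf, hfe⟩
    have hf' := Finset.mem_erase.1 hf
    rwa [← arcPair_injOn w (hU f hf'.2) he hfe]
  · exact fun h => ⟨e, Finset.mem_erase.2 h, rfl⟩

theorem IsTree.lt_and_lt (hm : 4 ≤ m) {c : ℕ → Bool} (hU : IsTree c 0 (m - 1) U) :
    ∀ e ∈ U, e.1 < e.2 ∧ e.2 < m := by
  intro e he
  have := hU.bounds e he
  omega

theorem IsTree.isPermissible_diagonals (hm : 4 ≤ m)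
    (hU : IsTree (fun i => c (w + (i : ZMod m))) 0 (m - 1) U) :
    IsPermissible m c (diagonals m w U) := by
  have : NeZero m := ⟨by omega⟩
  have hb := hU.lt_and_lt hm
  have hmem : ∀ e ∈ diagonals m w U, ∃ f ∈ U, f ≠ (0, m - 1) ∧ arcPair m w f = e := by
    intro e he
    obtain ⟨f, hf, rfl⟩ := Finset.mem_image.1 he
    exact ⟨f, Finset.mem_of_mem_erase hf, Finset.ne_of_mem_erase hf, rfl⟩
  refine ⟨⟨?_, ?_, ?_⟩, ?_⟩
  · rw [diagonals, Finset.card_image_of_injOn, Finset.card_erase_of_mem (hU.root_mem (by omega)),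
      hU.card_eq]
    · omega
    · exact (arcPair_injOn w).mono fun e he => hb e (Finset.mem_of_mem_erase he)
  · intro e he
    obtain ⟨f, hf, hne, rfl⟩ := hmem e he
    exact (isDiag_arcPair_iff hm (hb f hf).1 (hb f hf).2).2 ⟨(hU.bounds f hf).2.1, hne⟩
  · intro e he e' he' _
    obtain ⟨f, hf, -, rfl⟩ := hmem e he
    obtain ⟨f', hf', -, rfl⟩ := hmem e' he'
    rw [cross_arcPair_iff (hb f hf).1 (hb f hf).2 (hb f' hf').1 (hb f' hf').2]
    exact not_or.2 ⟨hU.not_cross f hf f' hf', hU.not_cross f' hf' f hf⟩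
  · intro e he
    obtain ⟨f, hf, -, rfl⟩ := hmem e he
    exact permitted_arcPair_iff.2 (hU.coloured f hf)

theorem IsPermissible.exists_isTree (hm : 4 ≤ m) (hw : c w = true) {T : Finset (Sym2 (ZMod m))}
    (hT : IsPermissible m c T) :
    ∃ U, IsTree (fun i => c (w + (i : ZMod m))) 0 (m - 1) U ∧ diagonals m w U = T := by
  have : NeZero m := ⟨by omega⟩
  classical
  obtain ⟨⟨hcard, hdiag, hcross⟩, hperm⟩ := hT
  let A : Finset (ℕ × ℕ) := (Finset.range m ×ˢ Finset.range m).filter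
    (fun e => e.1 < e.2 ∧ e ≠ (0, m - 1) ∧ arcPair m w e ∈ T)
  have hA : ∀ e, e ∈ A ↔ e.1 < e.2 ∧ e.2 < m ∧ e ≠ (0, m - 1) ∧ arcPair m w e ∈ T := by
    intro e
    simp only [A, Finset.mem_filter, Finset.mem_product, Finset.mem_range]
    constructor
    · rintro ⟨h₁, h₂, h₃⟩; exact ⟨h₂, h₁.2, h₃⟩
    · rintro ⟨h₁, h₂, h₃⟩; exact ⟨⟨by omega, h₂⟩, h₁, h₃⟩
  have himage : A.image (arcPair m w) = T := by
    ext e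
    rw [Finset.mem_image]
    constructor
    · rintro ⟨f, hf, rfl⟩
      exact ((hA f).1 hf).2.2.2
    · intro he
      obtain ⟨f, h₁, h₂, h₃, rfl⟩ := (hdiag e he).exists_arc hm w
      exact ⟨f, (hA f).2 ⟨by omega, h₂, h₃, he⟩, rfl⟩
  have hroot : (0, m - 1) ∉ A := fun h => ((hA _).1 h).2.2.1 rfl
  have hbA : ∀ e ∈ A, e.1 + 2 ≤ e.2 ∧ e.2 < m := by
    intro e he
    obtain ⟨h₁, h₂, -, h₃⟩ := (hA e).1 he
    exact ⟨((isDiag_arcPair_iff hm h₁ h₂).1 (hdiag _ h₃)).1, h₂⟩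
  have hcardA : A.card = m - 3 := by
    rw [← hcard, ← himage, Finset.card_image_of_injOn]
    exact (arcPair_injOn w).mono fun e he => by
      have := hbA e he
      exact ⟨by omega, this.2⟩
  refine ⟨insert (0, m - 1) A, ?_, by rw [diagonals, Finset.erase_insert hroot, himage]⟩
  refine (card_le_and_isTree _ _ 0 (m - 1) _ rfl (by omega) ?_ ?_).2 ?_ ?_
  · intro e he
    rcases Finset.mem_insert.1 he with rfl | he
    · simp only; omega
    · have := hbA e he; omega
  · intro e he f hf hef
    rcases Finset.mem_insert.1 he with rfl | he <;> rcases Finset.mem_insert.1 hf with rfl | hf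
    · simp only at hef; omega
    · have := hbA f hf; simp only at hef; omega
    · simp only at hef; omega
    · have h₁ := (hA e).1 he
      have h₂ := (hA f).1 hf
      refine hcross _ h₁.2.2.2 _ h₂.2.2.2 (fun h => ?_)
        ((cross_arcPair_iff h₁.1 h₁.2.1 h₂.1 h₂.2.1).2 (Or.inl hef))
      obtain rfl := arcPair_injOn w ⟨h₁.1, h₁.2.1⟩ ⟨h₂.1, h₂.2.1⟩ h
      exact lt_irrefl _ hef.1
  · rw [Finset.card_insert_of_notMem hroot, hcardA]
    omega
  · intro e he
    rcases Finset.mem_insert.1 he with rfl | he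
    · left; simpa using hw
    · exact permitted_arcPair_iff.1 (hperm _ ((hA e).1 he).2.2.2)

theorem diagonals_injOn (hm : 4 ≤ m) (w : ZMod m) (c : ℕ → Bool) :
    Set.InjOn (diagonals m w) {U | IsTree c 0 (m - 1) U} := by
  have : NeZero m := ⟨by omega⟩
  have hsub : ∀ U V, IsTree c 0 (m - 1) U → IsTree c 0 (m - 1) V →
      diagonals m w U = diagonals m w V → U ⊆ V := by
    intro U V hU hV h e he
    by_cases hroot : e = (0, m - 1)
    · rw [hroot]
      exact hV.root_mem (by omega)
    · have hb := hU.lt_and_lt hm e he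
      have := (arcPair_mem_diagonals_iff (w := w) (hU.lt_and_lt hm) hb).2 ⟨hroot, he⟩
      rw [h, arcPair_mem_diagonals_iff (hV.lt_and_lt hm) hb] at this
      exact this.2
  exact fun U hU V hV h => (hsub U V hU hV h).antisymm (hsub V U hV hU h.symm)

theorem exists_shellingKey_isPermissible (hm : 4 ≤ m) (hw : c w = true) :
    ∃ key : Finset (Sym2 (ZMod m)) → ℕ, IsShellingKey {T | IsPermissible m c T} key := by
  have : NeZero m := ⟨by omega⟩
  obtain ⟨k, hinj, hk⟩ :=
    exists_shellingKey_isTree (fun i => c (w + (i : ZMod m))) _ 0 (m - 1) rfl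
  have hG : ∀ T, ∃ U, IsPermissible m c T →
      IsTree (fun i => c (w + (i : ZMod m))) 0 (m - 1) U ∧ diagonals m w U = T := by
    intro T
    by_cases hT : IsPermissible m c T
    · obtain ⟨U, hU⟩ := hT.exists_isTree hm hw
      exact ⟨U, fun _ => hU⟩
    · exact ⟨∅, fun h => absurd h hT⟩
  choose G hG using hG
  refine ⟨fun T => k (G T), ?_, ?_⟩
  · intro T hT T' hT' h
    rw [← (hG T hT).2, ← (hG T' hT').2, hinj (hG T hT).1 (hG T' hT').1 h]
  · intro T hT T' hT' hlt
    obtain ⟨hU, hUT⟩ := hG T hT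
    obtain ⟨hU', hUT'⟩ := hG T' hT'
    obtain ⟨V, hV, hVlt, e, he, he', hsub⟩ := hk _ hU _ hU' hlt
    have hVp := IsTree.isPermissible_diagonals hm hV
    have hGV : G (diagonals m w V) = V :=
      diagonals_injOn hm w _ (hG _ hVp).1 hV (hG _ hVp).2
    have hroot : e ≠ (0, m - 1) := by
      rintro rfl
      exact he' (hU'.root_mem (by omega))
    have hbU := hU.lt_and_lt hm
    refine ⟨_, hVp, by simpa only [hGV] using hVlt, arcPair m w e, ?_, ?_, ?_⟩
    · rw [← hUT, arcPair_mem_diagonals_iff hbU (hbU e he)]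
      exact ⟨hroot, he⟩
    · rw [← hUT', arcPair_mem_diagonals_iff (hU'.lt_and_lt hm) (hbU e he)]
      exact fun h => he' h.2
    · intro f hf
      rw [Finset.mem_erase, ← hUT] at hf
      obtain ⟨hne, hf⟩ := hf
      obtain ⟨g, hg, rfl⟩ := Finset.mem_image.1 hf
      have hg := Finset.mem_erase.1 hg
      rw [arcPair_mem_diagonals_iff (hV.lt_and_lt hm) (hbU g hg.2)]
      exact ⟨hg.1, hsub (Finset.mem_erase.2 ⟨fun h => hne (by rw [h]), hg.2⟩)⟩

end Transfer

/-- For any bicolouring of `P_m` (`m ≥ 4`), there is an enumeration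
`T_1, …, T_N` of all permissible triangulations such that for all `j < k` there exists
`i < k` with `|T_i ∩ T_k| = m - 4` and `T_j ∩ T_k ⊆ T_i ∩ T_k` (Wilson's shelling
property). -/
theorem permitted_complex_shellable (m : ℕ) (hm : 4 ≤ m) (c : ZMod m → Bool)
    (hc : IsBicolouring m c) :
    ∃ N : ℕ, ∃ f : Fin N → Finset (Sym2 (ZMod m)),
      Function.Injective f ∧
      (∀ i, IsPermissible m c (f i)) ∧
      (∀ T, IsPermissible m c T → ∃ i, f i = T) ∧
      ∀ j k : Fin N, j < k →
        ∃ i : Fin N, i < k ∧ (f i ∩ f k).card = m - 4 ∧ f j ∩ f k ⊆ f i ∩ f k := by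
  have : NeZero m := ⟨by omega⟩
  obtain ⟨⟨w, hw⟩, -⟩ := hc
  obtain ⟨key, hinj, hkey⟩ := exists_shellingKey_isPermissible hm hw
  have hfin : {T | IsPermissible m c T}.Finite := Set.toFinite _
  set S := hfin.toFinset with hS
  have hmem : ∀ T, T ∈ S ↔ IsPermissible m c T := fun T => hfin.mem_toFinset
  let o := (S.image key).orderIsoOfFin rfl
  have ho : ∀ i, ∃ T, IsPermissible m c T ∧ key T = o i := by
    intro i
    obtain ⟨T, hT, h⟩ := Finset.mem_image.1 (o i).2
    exact ⟨T, (hmem T).1 hT, h⟩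
  choose f hf hfo using ho
  have hlt : ∀ i j, key (f i) < key (f j) ↔ i < j := by
    intro i j
    rw [hfo, hfo, Subtype.coe_lt_coe, o.lt_iff_lt]
  have hsurj : ∀ T, IsPermissible m c T → ∃ i, f i = T := by
    intro T hT
    refine ⟨o.symm ⟨key T, Finset.mem_image_of_mem key ((hmem T).2 hT)⟩, hinj (hf _) hT ?_⟩
    rw [hfo, o.apply_symm_apply]
  have hfinj : Function.Injective f := by
    intro i j h
    have h₁ := (hlt i j).not.1 (by rw [h]; exact lt_irrefl _)
    have h₂ := (hlt j i).not.1 (by rw [h]; exact lt_irrefl _)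
    exact le_antisymm (not_lt.1 h₂) (not_lt.1 h₁)
  refine ⟨_, f, hfinj, hf, hsurj, fun j k hjk => ?_⟩
  obtain ⟨T, hT, hTlt, e, he, hej, hsub⟩ := hkey _ (hf k) _ (hf j) ((hlt j k).2 hjk)
  obtain ⟨i, rfl⟩ := hsurj T hT
  have hik := (hlt i k).1 hTlt
  have hck := (hf k).1.1
  have hci := (hf i).1.1
  have hei : e ∉ f i := by
    intro hei
    refine hik.ne (hfinj (Finset.eq_of_subset_of_card_le (fun d hd => ?_) (by omega)).symm)
    by_cases hde : d = e
    · rwa [hde]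
    · exact hsub (Finset.mem_erase.2 ⟨hde, hd⟩)
  have hinter : f i ∩ f k = (f k).erase e := by
    ext d
    rw [Finset.mem_inter, Finset.mem_erase]
    exact ⟨fun h => ⟨fun hde => hei (hde ▸ h.1), h.2⟩,
      fun h => ⟨hsub (Finset.mem_erase.2 h), h.2⟩⟩
  refine ⟨i, hik, ?_, fun d hd => ?_⟩
  · rw [hinter, Finset.card_erase_of_mem he, hck]
    omega
  · rw [Finset.mem_inter] at hd
    rw [hinter, Finset.mem_erase]
    exact ⟨fun hde => hej (hde ▸ hd.1), hd.2⟩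

end Poly
end
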